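/- Let n ≥ 1 and m ≥ 1, let Δ ⊆ Δ' be open polydiscs centered at 0 in ℂⁿ, let ℳ ⊆ ℕⁿ be a co-ideal, let K ≥ 1, and suppose X ⊆ ℂⁿ admits decomposition with respect to (ℳ, Δ, Δ') with norm K. Let e ≥ 1 satisfy #{α ∈ ℳ : |α| = k} ≤ e·L(m,k) for all k ∈ ℕ. Let M ≥ 2 and let f₁,…,f_{m+1} be holomorphic on a neighborhood of the closure of Δ' with sup_{Δ'} |f_i| ≤ M for each i. For every ε > 0 there exist an integer d ≥ 1 depending only on m, ε, e and a constant C > 0 depending only on m, ε, e, K, M, with the following property: for every integer H ≥ 2, every 0 < δ < 1/2 with δ ≤ C·H^{−ε}, and every open polydisc D centered at 0 with D^δ := {δ^{−1}·z : z ∈ D} ⊆ Δ, setting Y := {(f₁(z),…,f_{m+1}(z)) : z ∈ X ∩ D} ⊆ ℂ^{m+1}, there exists a nonzero polynomial P ∈ ℂ[X₁,…,X_{m+1}] of total degree at most d vanishing at every point of Y(ℚ,H). -/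

import Mathlib

open scoped BigOperators

/-- The open polydisc in `ℂⁿ` centered at `0` of polyradius `r`. -/
def polydisc0 {n : ℕ} (r : Fin n → ℝ) : Set (Fin n → ℂ) :=
  {z | ∀ i, ‖z i‖ < r i}

/-- A co-ideal of multi-indices: downward closed under the componentwise order. -/
def IsCoideal {n : ℕ} (ℳ : Set (Fin n → ℕ)) : Prop :=
  ∀ α ∈ ℳ, ∀ β : Fin n → ℕ, (∀ i, β i ≤ α i) → β ∈ ℳ

/-- The monomial `z ^ α`. -/
def mon {n : ℕ} (α : Fin n → ℕ) (z : Fin n → ℂ) : ℂ := ∏ i, z i ^ α i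

/-- `L n k`: the number of monomials of degree exactly `k` in `n` variables. -/
def L (n k : ℕ) : ℕ := (n + k - 1).choose (n - 1)

/-- The data `(c, Q)` witnesses the decomposition of `F` with respect to
`(ℳ, Δ, Δ')` with norm `K`: `Q` is holomorphic on `Δ`, the series
`∑_{α ∈ ℳ} c_α z^α` converges on `Δ`, `F = ∑_{α ∈ ℳ} c_α z^α + Q` on `Δ`,
`Q` vanishes identically on `X ∩ Δ`, and
`sup_Δ ‖c_α z^α‖ ≤ K ⬝ sup_{Δ'} ‖F‖` for every `α ∈ ℳ`. -/
def IsDecompWitness {n : ℕ} (X : Set (Fin n → ℂ)) (ℳ : Set (Fin n → ℕ))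
    (Δ Δ' : Set (Fin n → ℂ)) (K : ℝ) (F : (Fin n → ℂ) → ℂ)
    (c : (Fin n → ℕ) → ℂ) (Q : (Fin n → ℂ) → ℂ) : Prop :=
  DifferentiableOn ℂ Q Δ ∧
  (∀ z ∈ Δ, Summable fun α : ℳ => c α.1 * mon α.1 z) ∧
  (∀ z ∈ Δ, F z = (∑' α : ℳ, c α.1 * mon α.1 z) + Q z) ∧
  (∀ z ∈ X ∩ Δ, Q z = 0) ∧
  (∀ α ∈ ℳ, ∀ z ∈ Δ, ‖c α * mon α z‖ ≤ K * sSup ((fun x => ‖F x‖) '' Δ'))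

/-- `X` admits decomposition with respect to `(ℳ, Δ, Δ')` with norm `K`:
every `F` holomorphic on a neighborhood of the closure of `Δ'` admits a
decomposition witness. -/
def AdmitsDecomposition {n : ℕ} (X : Set (Fin n → ℂ)) (ℳ : Set (Fin n → ℕ))
    (Δ Δ' : Set (Fin n → ℂ)) (K : ℝ) : Prop :=
  ∀ F : (Fin n → ℂ) → ℂ,
    (∃ V : Set (Fin n → ℂ), IsOpen V ∧ closure Δ' ⊆ V ∧ DifferentiableOn ℂ F V) →
    ∃ (c : (Fin n → ℕ) → ℂ) (Q : (Fin n → ℂ) → ℂ), IsDecompWitness X ℳ Δ Δ' K F c Q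

/-- The height of a rational number `a/b` in lowest terms (`b > 0`) is `max |a| b`. -/
def ratHeight (q : ℚ) : ℕ := max q.num.natAbs q.den

/-! ### Determinants -/

/-- If all determinants formed from rows of `v` vanish, the rows satisfy a common linear relation. -/
lemma exists_common_relation_of_det_eq_zero {ι Z : Type*} [Fintype ι] [DecidableEq ι]
    (v : Z → ι → ℂ) (h : ∀ w : ι → Z, (Matrix.of fun i j => v (w i) j).det = 0) :
    ∃ φ : ι → ℂ, φ ≠ 0 ∧ ∀ z, ∑ j, φ j * v z j = 0 := by
  have hlt : Submodule.span ℂ (Set.range v) < ⊤ := by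
    rw [lt_top_iff_ne_top]
    intro htop
    obtain ⟨κ, a, -, hspan, hli⟩ := exists_linearIndependent' ℂ v
    let b := Module.Basis.mk hli (by rw [hspan, htop])
    let σ := (Pi.basisFun ℂ ι).indexEquiv b
    have hrows : LinearIndependent ℂ (Matrix.of fun i j => v (a (σ i)) j).row :=
      hli.comp σ σ.injective
    rw [Matrix.linearIndependent_rows_iff_isUnit, Matrix.isUnit_iff_isUnit_det,
      h fun i => a (σ i)] at hrows
    exact not_isUnit_zero hrows
  obtain ⟨g, hg0, hg⟩ := Submodule.exists_le_ker_of_lt_top _ hlt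
  have hgv : ∀ x : ι → ℂ, ∑ j, g (Pi.single j 1) * x j = g x := by
    intro x
    conv_rhs => rw [pi_eq_sum_univ' x, map_sum]
    refine Finset.sum_congr rfl fun j _ => ?_
    rw [map_smul, smul_eq_mul, mul_comm]
  refine ⟨fun j => g (Pi.single j 1), fun h0 => hg0 ?_, fun z => ?_⟩
  · refine LinearMap.ext fun x => ?_
    rw [← hgv x]
    simp [show ∀ j, g (Pi.single j 1) = 0 from congrFun h0]
  · rw [hgv]
    exact hg (Submodule.subset_span ⟨z, rfl⟩)

lemma norm_det_le_factorial_mul_prod {ι : Type*} [Fintype ι] [DecidableEq ι] (A : Matrix ι ι ℂ)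
    (b : ι → ℝ) (hA : ∀ i j, ‖A i j‖ ≤ b i) :
    ‖A.det‖ ≤ (Fintype.card ι).factorial * ∏ i, b i := by
  rw [Matrix.det_apply]
  calc ‖∑ σ : Equiv.Perm ι, Equiv.Perm.sign σ • ∏ i, A (σ i) i‖
      ≤ ∑ _σ : Equiv.Perm ι, ∏ i, b i := by
        refine norm_sum_le_of_le _ fun σ _ => ?_
        have hsign : ‖Equiv.Perm.sign σ • ∏ i, A (σ i) i‖ = ‖∏ i, A (σ i) i‖ := by
          rcases Int.units_eq_one_or (Equiv.Perm.sign σ) with h | h <;> simp [h]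
        rw [hsign, norm_prod, ← Equiv.prod_comp σ b]
        exact Finset.prod_le_prod (fun _ _ => norm_nonneg _) fun i _ => hA _ _
    _ = _ := by simp [Fintype.card_perm]

/-- More rows from a product through `κ` than `κ` has elements force the determinant to vanish. -/
lemma det_piecewise_mul_eq_zero {ι κ : Type*} [Fintype ι] [DecidableEq ι] [Fintype κ]
    (U : Matrix ι κ ℂ) (W : Matrix κ ι ℂ) (R : Matrix ι ι ℂ) (S : Finset ι)
    (hS : Fintype.card κ < S.card) :
    Matrix.det (S.piecewise (U * W) R : Matrix ι ι ℂ) = 0 := by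
  by_contra hdet
  have hli := Matrix.linearIndependent_rows_of_det_ne_zero hdet
  have hsub : LinearIndependent ℂ ((U.submatrix ((↑) : S → ι) id) * W).row := by
    have hrow : ((U.submatrix ((↑) : S → ι) id) * W).row =
        fun i : S => (S.piecewise (U * W) R : Matrix ι ι ℂ) i := by
      funext i
      exact (Finset.piecewise_eq_of_mem S (U * W) R i.2).symm
    rw [hrow]
    exact hli.comp ((↑) : S → ι) Subtype.val_injective
  have h1 := hsub.rank_matrix
  have h2 := (Matrix.rank_mul_le_left (U.submatrix ((↑) : S → ι) id) W).trans
    (Matrix.rank_le_card_width _)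
  rw [h1, Fintype.card_coe] at h2
  omega

/-- A small perturbation of a low-rank matrix has a small determinant. -/
lemma norm_det_mul_add_le {ι κ : Type*} [Fintype ι] [DecidableEq ι] [Fintype κ]
    (U : Matrix ι κ ℂ) (W : Matrix κ ι ℂ) (R : Matrix ι ι ℂ) {B η : ℝ} (hB : 0 ≤ B)
    (hη : 0 ≤ η) (hη1 : η ≤ 1) (hT : ∀ i j, ‖(U * W) i j‖ ≤ B) (hR : ∀ i j, ‖R i j‖ ≤ B * η)
    {h : ℕ} (hh : Fintype.card κ + h ≤ Fintype.card ι) :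
    ‖(U * W + R).det‖ ≤
      2 ^ Fintype.card ι * (Fintype.card ι).factorial * B ^ Fintype.card ι * η ^ h := by
  have hexp : (U * W + R).det =
      ∑ S : Finset ι, Matrix.det (S.piecewise (U * W) R : Matrix ι ι ℂ) :=
    (Matrix.detRowAlternating (R := ℂ) (n := ι)).toMultilinearMap.map_add_univ (U * W) R
  rw [hexp]
  calc _ ≤ ∑ _S : Finset ι,
        ((Fintype.card ι).factorial * B ^ Fintype.card ι * η ^ h : ℝ) := by
        refine norm_sum_le_of_le _ fun S _ => ?_
        rcases lt_or_ge (Fintype.card κ) S.card with hS | hS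
        · rw [det_piecewise_mul_eq_zero U W R S hS, norm_zero]
          positivity
        · refine (norm_det_le_factorial_mul_prod _ (fun i => B * if i ∈ S then 1 else η)
            fun i j => ?_).trans ?_
          · by_cases hi : i ∈ S
            · rw [congrFun (Finset.piecewise_eq_of_mem S (U * W) R hi) j, if_pos hi, mul_one]
              exact hT i j
            · rw [congrFun (Finset.piecewise_eq_of_notMem S (U * W) R hi) j, if_neg hi]
              exact hR i j
          · rw [mul_assoc, Finset.prod_mul_distrib, Finset.prod_const, Finset.card_univ]
            gcongr
            rw [Finset.prod_ite]
            simp only [Finset.prod_const_one, Finset.prod_const, one_mul]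
            refine pow_le_pow_of_le_one hη hη1 ?_
            rw [← Finset.compl_filter, Finset.filter_univ_mem, Finset.card_compl]
            omega
    _ = _ := by
        simp only [Finset.sum_const, Finset.card_univ, Fintype.card_finset, nsmul_eq_mul]
        push_cast
        ring

/-- A determinant of monomials in rational points of bounded height is zero or bounded below. -/
lemma one_le_pow_mul_norm_det {ι σ : Type*} [Fintype ι] [DecidableEq ι] [Fintype σ]
    (q : ι → σ → ℚ) (β : ι → σ → ℕ) {b H : ℕ} (hβ : ∀ j k, β j k ≤ b)
    (hq : ∀ i k, (q i k).den ≤ H) (A : Matrix ι ι ℂ)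
    (hA : ∀ i j, A i j = ∏ k, (q i k : ℂ) ^ β j k) (hdet : A.det ≠ 0) :
    1 ≤ (H : ℝ) ^ (Fintype.card σ * b * Fintype.card ι) * ‖A.det‖ := by
  let v : ι → ℕ := fun i => ∏ k, (q i k).den ^ b
  let B : Matrix ι ι ℤ := Matrix.of fun i j =>
    ∏ k, (q i k).num ^ β j k * ((q i k).den : ℤ) ^ (b - β j k)
  have hB : (Matrix.of fun i j => (v i : ℂ) * A i j) = B.map (Int.castRingHom ℂ) := by
    ext i j
    simp only [Matrix.of_apply, Matrix.map_apply, v, B, hA, Int.coe_castRingHom]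
    push_cast
    rw [← Finset.prod_mul_distrib]
    refine Finset.prod_congr rfl fun k _ => ?_
    have hden : ((q i k).den : ℂ) ≠ 0 := Nat.cast_ne_zero.mpr (q i k).den_nz
    rw [← Nat.sub_add_cancel (hβ j k), pow_add, Nat.add_sub_cancel, mul_assoc, ← mul_pow,
      Rat.cast_def, mul_div_cancel₀ _ hden, mul_comm]
  have hdetB : (∏ i, (v i : ℂ)) * A.det = (B.det : ℂ) := by
    rw [← Matrix.det_mul_column, hB]
    exact (RingHom.map_det (Int.castRingHom ℂ) B).symm
  have hv : ∀ i, v i ≠ 0 := fun i => Finset.prod_ne_zero_iff.mpr fun k _ =>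
    pow_ne_zero _ (q i k).den_nz
  have hB0 : B.det ≠ 0 := by
    intro h0
    rw [h0, Int.cast_zero, mul_eq_zero, Finset.prod_eq_zero_iff] at hdetB
    rcases hdetB with ⟨i, -, hi⟩ | h
    · exact hv i (by exact_mod_cast hi)
    · exact hdet h
  have hvH : ∀ i, (v i : ℝ) ≤ (H : ℝ) ^ (Fintype.card σ * b) := by
    intro i
    have : v i ≤ ∏ _k : σ, H ^ b := Finset.prod_le_prod' fun k _ => Nat.pow_le_pow_left (hq i k) b
    rw [Finset.prod_const, Finset.card_univ, ← pow_mul, mul_comm] at this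
    exact_mod_cast this
  calc (1 : ℝ) ≤ ‖(B.det : ℂ)‖ := by
        rw [Complex.norm_intCast]
        exact_mod_cast Int.one_le_abs hB0
    _ = (∏ i, (v i : ℝ)) * ‖A.det‖ := by
        rw [← hdetB, norm_mul, norm_prod]
        simp
    _ ≤ _ := by
        gcongr
        calc ∏ i, (v i : ℝ) ≤ ∏ _i : ι, (H : ℝ) ^ (Fintype.card σ * b) :=
              Finset.prod_le_prod (fun _ _ => Nat.cast_nonneg _) fun i _ => hvH i
          _ = _ := by rw [Finset.prod_const, Finset.card_univ, ← pow_mul]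

/-! ### Co-ideals of bounded growth -/

lemma summable_L_mul_half_pow {m : ℕ} (hm : 1 ≤ m) :
    Summable fun k => (L m k : ℝ) * (1 / 2) ^ k := by
  have h := summable_choose_mul_geometric_of_norm_lt_one (m - 1) (r := (1 / 2 : ℝ)) (by norm_num)
  refine h.congr fun k => ?_
  rw [L, show m + k - 1 = k + (m - 1) by omega]

lemma finite_setOf_sum_lt (n N : ℕ) : {α : Fin n → ℕ | ∑ i, α i < N}.Finite :=
  (Set.finite_Iic fun _ => N).subset fun α hα i =>
    (Finset.single_le_sum (f := α) (fun _ _ => Nat.zero_le _) (Finset.mem_univ i)).trans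
      (le_of_lt hα)

section Growth

variable {n m e : ℕ} {ℳ : Set (Fin n → ℕ)}

lemma card_filter_sum_eq_le
    (hcard : ∀ k : ℕ, ({α ∈ ℳ | (∑ i, α i) = k}).ncard ≤ e * L m k) (s : Finset ℳ) (k : ℕ) :
    (s.filter fun α => ∑ i, α.1 i = k).card ≤ e * L m k := by
  classical
  refine le_trans ?_ (hcard k)
  rw [← Finset.card_image_of_injective _ Subtype.val_injective, ← Set.ncard_coe_finset]
  refine Set.ncard_le_ncard ?_ ((finite_setOf_sum_lt n (k + 1)).subset fun α hα => ?_)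
  · intro α hα
    simp only [Finset.coe_image, Finset.coe_filter, Set.mem_image, Set.mem_ofPred_eq] at hα
    obtain ⟨α, ⟨-, h⟩, rfl⟩ := hα
    exact ⟨α.2, h⟩
  · exact Nat.lt_succ_of_le hα.2.le

lemma card_le_of_sum_lt
    (hcard : ∀ k : ℕ, ({α ∈ ℳ | (∑ i, α i) = k}).ncard ≤ e * L m k) (hm : 1 ≤ m) (s : Finset ℳ)
    {N : ℕ} (hs : ∀ α ∈ s, ∑ i, α.1 i < N) : s.card ≤ e * (N + m) ^ m := by
  rw [Finset.card_eq_sum_card_fiberwise (f := fun α : ℳ => ∑ i, α.1 i) (t := Finset.range N)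
    fun α hα => by simpa using hs α hα]
  calc _ ≤ ∑ _k ∈ Finset.range N, e * (N + m) ^ (m - 1) := by
        refine Finset.sum_le_sum fun k hk => (card_filter_sum_eq_le hcard s k).trans ?_
        have hk := Finset.mem_range.mp hk
        refine Nat.mul_le_mul_left _ ((Nat.choose_le_pow _ _).trans ?_)
        exact Nat.pow_le_pow_left (by omega) _
    _ ≤ e * ((N + m) ^ (m - 1) * (N + m)) := by
        rw [Finset.sum_const, Finset.card_range, smul_eq_mul]
        have := Nat.mul_le_mul_left (e * (N + m) ^ (m - 1)) (Nat.le_add_right N m)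
        linarith
    _ = e * (N + m) ^ m := by rw [← pow_succ, Nat.sub_add_cancel hm]

lemma sum_half_pow_le
    (hcard : ∀ k : ℕ, ({α ∈ ℳ | (∑ i, α i) = k}).ncard ≤ e * L m k) (hm : 1 ≤ m)
    (s : Finset ℳ) :
    ∑ α ∈ s, (1 / 2 : ℝ) ^ (∑ i, α.1 i) ≤ e * ∑' k, (L m k : ℝ) * (1 / 2) ^ k := by
  classical
  rw [← Finset.sum_fiberwise_of_maps_to (g := fun α : ℳ => ∑ i, α.1 i)
    (t := s.image fun α : ℳ => ∑ i, α.1 i) fun α hα => Finset.mem_image_of_mem _ hα]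
  calc _ ≤ ∑ k ∈ s.image fun α : ℳ => ∑ i, α.1 i, e * ((L m k : ℝ) * (1 / 2) ^ k) := by
        refine Finset.sum_le_sum fun k _ => ?_
        rw [Finset.sum_congr rfl (g := fun _ => (1 / 2 : ℝ) ^ k) fun α hα => by
          rw [(Finset.mem_filter.mp hα).2], Finset.sum_const, nsmul_eq_mul, ← mul_assoc]
        gcongr
        exact_mod_cast card_filter_sum_eq_le hcard s k
    _ ≤ _ := by
        rw [← Finset.mul_sum]
        gcongr
        exact (summable_L_mul_half_pow hm).sum_le_tsum _ fun _ _ => by positivity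

/-- The part of degree at least `N` of a series over `ℳ` with geometrically decaying terms. -/
lemma norm_tsum_sub_sum_le
    (hcard : ∀ k : ℕ, ({α ∈ ℳ | (∑ i, α i) = k}).ncard ≤ e * L m k) (hm : 1 ≤ m)
    {t : ℳ → ℂ} (ht : Summable t) {A δ : ℝ} (hA : 0 ≤ A) (hδ : 0 ≤ δ) (hδ2 : δ ≤ 1 / 2)
    (hbound : ∀ α, ‖t α‖ ≤ A * δ ^ (∑ i, α.1 i)) {N : ℕ} (s : Finset ℳ)
    (hs : ∀ α ∉ s, N ≤ ∑ i, α.1 i) :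
    ‖∑' α, t α - ∑ α ∈ s, t α‖ ≤
      A * 2 ^ N * (e * ∑' k, (L m k : ℝ) * (1 / 2) ^ k) * δ ^ N := by
  have hhalf : Summable fun α : ℳ => (1 / 2 : ℝ) ^ (∑ i, α.1 i) :=
    summable_of_sum_le (fun α => by positivity) (sum_half_pow_le hcard hm)
  have hsum : ∑' α : ℳ, (1 / 2 : ℝ) ^ (∑ i, α.1 i) ≤ e * ∑' k, (L m k : ℝ) * (1 / 2) ^ k :=
    Real.tsum_le_of_sum_le (fun α => by positivity) (sum_half_pow_le hcard hm)
  have htail : ∀ α : {α // α ∉ s}, ‖t α‖ ≤ A * (2 * δ) ^ N * (1 / 2) ^ (∑ i, α.1.1 i) := by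
    intro α
    refine (hbound α).trans ?_
    rw [mul_assoc]
    gcongr
    obtain ⟨j, hj⟩ := Nat.exists_eq_add_of_le (hs α α.2)
    rw [hj, pow_add, pow_add, ← mul_assoc, ← mul_pow]
    rw [show 2 * δ * (1 / 2) = δ by ring]
    gcongr
  have hsplit := ht.sum_add_tsum_subtype_compl s
  rw [← hsplit, add_sub_cancel_left]
  refine (tsum_of_norm_bounded ((hhalf.subtype _).mul_left _).hasSum htail).trans ?_
  rw [tsum_mul_left]
  calc _ ≤ A * (2 * δ) ^ N * (e * ∑' k, (L m k : ℝ) * (1 / 2) ^ k) := by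
        gcongr
        exact (Summable.tsum_subtype_le _ _ (fun α => by positivity) hhalf).trans hsum
    _ = _ := by rw [mul_pow]; ring

end Growth

/-! ### Sampling decomposable functions on a small polydisc -/

lemma mon_smul {n : ℕ} (α : Fin n → ℕ) (a : ℂ) (z : Fin n → ℂ) :
    mon α (a • z) = a ^ (∑ i, α i) * mon α z := by
  simp only [mon, Pi.smul_apply, smul_eq_mul, mul_pow, Finset.prod_mul_distrib,
    Finset.prod_pow_eq_pow_sum]

lemma mem_polydisc0_of_smul_mem {n : ℕ} {r : Fin n → ℝ} {δ : ℝ} (hδ : 0 < δ) (hδ1 : δ ≤ 1)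
    {z : Fin n → ℂ} (hz : (δ⁻¹ : ℂ) • z ∈ polydisc0 r) : z ∈ polydisc0 r := by
  intro i
  refine lt_of_le_of_lt ?_ (hz i)
  rw [Pi.smul_apply, smul_eq_mul, norm_mul, norm_inv, Complex.norm_real,
    Real.norm_of_nonneg hδ.le]
  exact le_mul_of_one_le_left (norm_nonneg _) (one_le_inv_iff₀.mpr ⟨hδ, hδ1⟩)

lemma norm_mul_mon_le_of_smul {n : ℕ} {α : Fin n → ℕ} {c : ℂ} {z : Fin n → ℂ} {A δ : ℝ}
    (hδ : 0 < δ) (h : ‖c * mon α ((δ⁻¹ : ℂ) • z)‖ ≤ A) :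
    ‖c * mon α z‖ ≤ A * δ ^ (∑ i, α i) := by
  have hz : c * mon α z = c * mon α ((δ⁻¹ : ℂ) • z) * (δ : ℂ) ^ (∑ i, α i) := by
    have hδ0 : (δ : ℂ) ≠ 0 := by exact_mod_cast hδ.ne'
    rw [mon_smul, inv_pow]
    field_simp
  rw [hz, norm_mul, norm_pow, Complex.norm_real, Real.norm_of_nonneg hδ.le]
  gcongr

/-- The interpolation determinant of decomposable functions at points of a small polydisc. -/
lemma norm_det_samples_le {n m e : ℕ} (hm : 1 ≤ m) {ι : Type*} [Fintype ι] [DecidableEq ι]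
    {rΔ rΔ' : Fin n → ℝ} (hsub : polydisc0 rΔ ⊆ polydisc0 rΔ') {ℳ : Set (Fin n → ℕ)}
    {X : Set (Fin n → ℂ)} {K : ℝ} (hK : 0 ≤ K)
    (hX : AdmitsDecomposition X ℳ (polydisc0 rΔ) (polydisc0 rΔ') K)
    (hcard : ∀ k : ℕ, ({α ∈ ℳ | (∑ i, α i) = k}).ncard ≤ e * L m k)
    (g : ι → (Fin n → ℂ) → ℂ)
    (hg : ∀ j, ∃ V : Set (Fin n → ℂ), IsOpen V ∧ closure (polydisc0 rΔ') ⊆ V ∧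
      DifferentiableOn ℂ (g j) V)
    {G : ℝ} (hG : 0 ≤ G) (hgG : ∀ j, ∀ z ∈ polydisc0 rΔ', ‖g j z‖ ≤ G)
    {δ : ℝ} (hδ : 0 < δ) (hδ2 : δ ≤ 1 / 2) (z : ι → Fin n → ℂ) (hzX : ∀ i, z i ∈ X)
    (hz : ∀ i, (δ⁻¹ : ℂ) • z i ∈ polydisc0 rΔ)
    {N h : ℕ} (hN : e * (N + m) ^ m + h ≤ Fintype.card ι) :
    ‖(Matrix.of fun i j => g j (z i)).det‖ ≤
      2 ^ Fintype.card ι * (Fintype.card ι).factorial *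
        (G + K * G * 2 ^ N * (e * ∑' k, (L m k : ℝ) * (1 / 2) ^ k)) ^ Fintype.card ι *
        (δ ^ N) ^ h := by
  choose c Q hcQ using fun j => hX (g j) (hg j)
  have hzΔ : ∀ i, z i ∈ polydisc0 rΔ := fun i =>
    mem_polydisc0_of_smul_mem hδ (hδ2.trans (by norm_num)) (hz i)
  let s : Finset ℳ :=
    ((finite_setOf_sum_lt n N).preimage (Subtype.val_injective (p := (· ∈ ℳ))).injOn).toFinset
  have hs : ∀ α, α ∈ s ↔ ∑ i, α.1 i < N := fun α => by simp [s]
  have hS0 : 0 ≤ ∑' k, (L m k : ℝ) * (1 / 2) ^ k := tsum_nonneg fun k => by positivity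
  set S : ℝ := e * ∑' k, (L m k : ℝ) * (1 / 2) ^ k
  let U : Matrix ι s ℂ := Matrix.of fun i α => mon α.1.1 (z i)
  let W : Matrix s ι ℂ := Matrix.of fun α j => c j α.1.1
  have hUW : ∀ i j, (U * W) i j = ∑ α ∈ s, c j α.1 * mon α.1 (z i) := fun i j => by
    rw [Matrix.mul_apply, ← Finset.sum_coe_sort s]
    exact Finset.sum_congr rfl fun α _ => mul_comm _ _
  let R : Matrix ι ι ℂ := (Matrix.of fun i j => g j (z i)) - U * W
  have hR : ∀ i j, ‖R i j‖ ≤ K * G * 2 ^ N * S * δ ^ N := by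
    intro i j
    obtain ⟨-, hsummable, heq, hQ, hbound⟩ := hcQ j
    have hval : g j (z i) = ∑' α : ℳ, c j α.1 * mon α.1 (z i) := by
      rw [heq _ (hzΔ i), hQ _ ⟨hzX i, hzΔ i⟩, add_zero]
    have hRij : R i j =
        ∑' α : ℳ, c j α.1 * mon α.1 (z i) - ∑ α ∈ s, c j α.1 * mon α.1 (z i) := by
      rw [← hUW, ← hval]
      rfl
    rw [hRij]
    refine norm_tsum_sub_sum_le hcard hm (hsummable _ (hzΔ i)) (mul_nonneg hK hG) hδ.le hδ2
      (fun α => norm_mul_mon_le_of_smul hδ ((hbound α α.2 _ (hz i)).trans ?_)) s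
      fun α hα => not_lt.mp fun hlt => hα ((hs α).mpr hlt)
    refine mul_le_mul_of_nonneg_left (Real.sSup_le ?_ hG) hK
    rintro _ ⟨x, hx, rfl⟩
    exact hgG j x hx
  have hδN : δ ^ N ≤ 1 := pow_le_one₀ hδ.le (hδ2.trans (by norm_num))
  have hKS : 0 ≤ K * G * 2 ^ N * S := by positivity
  have hdecomp : (Matrix.of fun i j => g j (z i)) = U * W + R := (add_sub_cancel _ _).symm
  have hT : ∀ i j, ‖(U * W) i j‖ ≤ G + K * G * 2 ^ N * S := by
    intro i j
    have hij : (U * W) i j = g j (z i) - R i j := by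
      simp [R]
    rw [hij]
    refine (norm_sub_le _ _).trans (add_le_add (hgG j _ (hsub (hzΔ i))) ((hR i j).trans ?_))
    exact mul_le_of_le_one_right hKS hδN
  rw [hdecomp]
  refine norm_det_mul_add_le U W R (by positivity) (by positivity) hδN hT (fun i j => ?_) ?_
  · refine (hR i j).trans ?_
    gcongr
    linarith
  · have := card_le_of_sum_lt hcard hm s fun α hα => (hs α).mp hα
    rw [Fintype.card_coe]
    omega

/-! ### Rational points -/

/-- The polynomial with exponents in a box and prescribed coefficients. -/
lemma exists_mvPolynomial_of_coeff {k b : ℕ} (φ : (Fin k → Fin b) → ℂ) (hφ : φ ≠ 0) :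
    ∃ P : MvPolynomial (Fin k) ℂ, P ≠ 0 ∧ P.totalDegree ≤ k * b ∧
      ∀ y : Fin k → ℂ, MvPolynomial.eval y P = ∑ β, φ β * ∏ i, y i ^ (β i : ℕ) := by
  classical
  let E : (Fin k → Fin b) → (Fin k →₀ ℕ) := fun β => Finsupp.equivFunOnFinite.symm fun i => β i
  have hE : Function.Injective E := fun β γ h => by
    funext i
    exact Fin.ext (by simpa [E] using DFunLike.congr_fun h i)
  refine ⟨∑ β, MvPolynomial.monomial (E β) (φ β), fun h0 => hφ ?_, ?_, fun y => ?_⟩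
  · funext β
    have := congrArg (MvPolynomial.coeff (E β)) h0
    simpa [MvPolynomial.coeff_sum, MvPolynomial.coeff_monomial, hE.eq_iff] using this
  · refine MvPolynomial.totalDegree_finsetSum_le fun β _ =>
      (MvPolynomial.totalDegree_monomial_le _ _).trans ?_
    rw [Finsupp.sum_fintype _ _ fun _ => rfl]
    calc ∑ i, id (E β i) ≤ ∑ _i : Fin k, b := Finset.sum_le_sum fun i _ => (β i).2.le
      _ = k * b := by simp
  · rw [map_sum]
    refine Finset.sum_congr rfl fun β _ => ?_
    rw [MvPolynomial.eval_monomial, Finsupp.prod_fintype _ _ fun _ => pow_zero _]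
    rfl

lemma differentiableOn_prod_pow_nhds {n k : ℕ} {S : Set (Fin n → ℂ)}
    (f : Fin k → (Fin n → ℂ) → ℂ)
    (hf : ∀ i, ∃ V : Set (Fin n → ℂ), IsOpen V ∧ S ⊆ V ∧ DifferentiableOn ℂ (f i) V)
    (β : Fin k → ℕ) :
    ∃ V : Set (Fin n → ℂ), IsOpen V ∧ S ⊆ V ∧
      DifferentiableOn ℂ (fun z => ∏ i, f i z ^ β i) V := by
  choose V hVo hSV hV using hf
  refine ⟨⋂ i, V i, isOpen_iInter_of_finite hVo, Set.subset_iInter hSV, ?_⟩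
  intro z hz
  exact (HasFDerivWithinAt.finsetProd fun i _ =>
    (((hV i).mono (Set.iInter_subset _ i)).fun_pow (β i) z hz).hasFDerivWithinAt
    ).differentiableWithinAt

lemma norm_prod_pow_le {k b : ℕ} {M : ℝ} (hM : 1 ≤ M) (y : Fin k → ℂ) (hy : ∀ i, ‖y i‖ ≤ M)
    (β : Fin k → Fin b) : ‖∏ i, y i ^ (β i : ℕ)‖ ≤ (M ^ b) ^ k := by
  rw [norm_prod]
  calc _ ≤ ∏ _i : Fin k, M ^ b := by
        refine Finset.prod_le_prod (fun _ _ => norm_nonneg _) fun i _ => ?_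
        rw [norm_pow]
        exact (pow_le_pow_left₀ (norm_nonneg _) (hy i) _).trans
          (pow_le_pow_right₀ hM (β i).2.le)
    _ = _ := by simp

/-- The choice of `C` makes the upper bound for the determinant beat the height bound. -/
lemma pow_mul_lt_one_of_le_mul_rpow {c δ ε : ℝ} (hc : 0 ≤ c) (hδ : 0 ≤ δ) {H E F : ℕ} (hH : 1 ≤ H)
    (hF : F ≠ 0) (hEF : (E : ℝ) ≤ ε * F) (hle : δ ≤ (c + 1)⁻¹ * (H : ℝ) ^ (-ε)) :
    (H : ℝ) ^ E * (c * δ ^ F) < 1 := by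
  have hH0 : (0 : ℝ) < H := by exact_mod_cast hH
  have hC1 : (c + 1)⁻¹ ≤ 1 := inv_le_one_of_one_le₀ (by linarith)
  have hHE : (H : ℝ) ^ E * ((H : ℝ) ^ (-ε)) ^ F ≤ 1 := by
    rw [← Real.rpow_natCast, ← Real.rpow_natCast, ← Real.rpow_mul hH0.le, ← Real.rpow_add hH0]
    exact Real.rpow_le_one_of_one_le_of_nonpos (by exact_mod_cast hH) (by linarith)
  calc (H : ℝ) ^ E * (c * δ ^ F)
      ≤ (H : ℝ) ^ E * (c * ((c + 1)⁻¹ * (H : ℝ) ^ (-ε)) ^ F) := by gcongr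
    _ = c * ((c + 1)⁻¹) ^ F * ((H : ℝ) ^ E * ((H : ℝ) ^ (-ε)) ^ F) := by rw [mul_pow]; ring
    _ ≤ c * (c + 1)⁻¹ * 1 := by
        gcongr
        exact pow_le_of_le_one (by positivity) hC1 hF
    _ < 1 := by
        rw [mul_one, ← div_eq_mul_inv, div_lt_one (by linarith)]
        linarith

theorem hypersurface_selection_corollary
    (m : ℕ) (hm : 1 ≤ m) (e : ℕ) (he : 1 ≤ e) (ε : ℝ) (hε : 0 < ε) :
    ∃ d : ℕ, 1 ≤ d ∧ ∀ K : ℝ, 1 ≤ K → ∀ M : ℝ, 2 ≤ M →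
    ∃ C > (0 : ℝ), ∀ n : ℕ, 1 ≤ n →
      ∀ rΔ rΔ' : Fin n → ℝ, (∀ i, 0 < rΔ i) → (∀ i, 0 < rΔ' i) →
      polydisc0 rΔ ⊆ polydisc0 rΔ' →
      ∀ ℳ : Set (Fin n → ℕ), IsCoideal ℳ →
      ∀ X : Set (Fin n → ℂ),
      AdmitsDecomposition X ℳ (polydisc0 rΔ) (polydisc0 rΔ') K →
      (∀ k : ℕ, ({α ∈ ℳ | (∑ i, α i) = k}).ncard ≤ e * L m k) →
      ∀ f : Fin (m + 1) → (Fin n → ℂ) → ℂ,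
      (∀ i, ∃ V : Set (Fin n → ℂ), IsOpen V ∧ closure (polydisc0 rΔ') ⊆ V ∧
        DifferentiableOn ℂ (f i) V) →
      (∀ i, ∀ z ∈ polydisc0 rΔ', ‖f i z‖ ≤ M) →
      ∀ H : ℕ, 2 ≤ H →
      ∀ δ : ℝ, 0 < δ → δ < 1 / 2 → δ ≤ C * (H : ℝ) ^ (-ε) →
      ∀ rD : Fin n → ℝ, (∀ i, 0 < rD i) →
      (fun z => (δ⁻¹ : ℂ) • z) '' polydisc0 rD ⊆ polydisc0 rΔ →
      ∃ P : MvPolynomial (Fin (m + 1)) ℂ, P ≠ 0 ∧ P.totalDegree ≤ d ∧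
        ∀ z ∈ X ∩ polydisc0 rD,
          (∀ i, ∃ q : ℚ, ratHeight q ≤ H ∧ f i z = (q : ℂ)) →
          MvPolynomial.eval (fun i => f i z) P = 0 := by
  obtain ⟨A, hA⟩ := exists_nat_ge (2 * (m + 1) / ε)
  rw [div_le_iff₀ hε] at hA
  have hApos : 0 < A := by
    rcases Nat.eq_zero_or_pos A with rfl | h
    · rw [Nat.cast_zero, zero_mul] at hA
      have : (0 : ℝ) < 2 * (m + 1) := by positivity
      linarith
    · exact h
  obtain ⟨t, ht⟩ : ∃ t, t = e * (A + m) ^ m := ⟨_, rfl⟩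
  have htpos : 0 < t := by rw [ht]; positivity
  obtain ⟨b, hb⟩ : ∃ b, b = 2 * t := ⟨_, rfl⟩
  have hbpos : 0 < b := by omega
  have hcardι : Fintype.card (Fin (m + 1) → Fin b) = 2 * (t * b ^ m) := by
    rw [Fintype.card_fun, Fintype.card_fin, Fintype.card_fin, pow_succ]
    nth_rewrite 2 [hb]
    ring
  have hN : e * (A * b + m) ^ m + t * b ^ m ≤ Fintype.card (Fin (m + 1) → Fin b) := by
    have h1 : (A * b + m) ^ m ≤ ((A + m) * b) ^ m :=
      Nat.pow_le_pow_left (by nlinarith) _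
    have h2 := Nat.mul_le_mul_left e h1
    rw [mul_pow, ← mul_assoc, ← ht] at h2
    omega
  refine ⟨(m + 1) * b, Nat.mul_pos m.succ_pos hbpos, fun K hK M hM => ?_⟩
  let G : ℝ := (M ^ b) ^ (m + 1)
  let B : ℝ := G + K * G * 2 ^ (A * b) * (e * ∑' k, (L m k : ℝ) * (1 / 2) ^ k)
  let μ : ℕ := Fintype.card (Fin (m + 1) → Fin b)
  let c : ℝ := 2 ^ μ * μ.factorial * B ^ μ
  have hG : 0 ≤ G := by positivity
  have hB : 0 ≤ B := by
    have : 0 ≤ ∑' k, (L m k : ℝ) * (1 / 2) ^ k := tsum_nonneg fun k => by positivity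
    positivity
  have hc : 0 ≤ c := by positivity
  refine ⟨(c + 1)⁻¹, by positivity, ?_⟩
  intro n _ rΔ rΔ' _ _ hsub ℳ _ X hX hcard f hf hfM H hH δ hδ hδ2 hδC rD _ hD
  let Z : Type := {z : Fin n → ℂ // z ∈ X ∩ polydisc0 rD ∧
    ∀ i, ∃ q : ℚ, ratHeight q ≤ H ∧ f i z = (q : ℂ)}
  obtain ⟨φ, hφ, hrel⟩ := exists_common_relation_of_det_eq_zero
    (fun (z : Z) (β : Fin (m + 1) → Fin b) => ∏ i, f i z.1 ^ (β i : ℕ)) fun w => by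
      by_contra hdet
      choose q hqH hq using fun i => (w i).2.2
      have hlower := one_le_pow_mul_norm_det q (fun β k => (β k : ℕ)) (b := b) (H := H)
        (fun β k => (β k).2.le) (fun i k => (le_max_right _ _).trans (hqH i k)) _
        (fun i β => by simp only [Matrix.of_apply, hq]) hdet
      have hupper := norm_det_samples_le hm hsub (zero_le_one.trans hK) hX hcard
        (fun (β : Fin (m + 1) → Fin b) z => ∏ i, f i z ^ (β i : ℕ))
        (fun β => differentiableOn_prod_pow_nhds f hf fun i => β i) hG
        (fun β z hz => norm_prod_pow_le (by linarith) _ (fun i => hfM i z hz) β) hδ hδ2.le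
        (fun i => (w i).1) (fun i => (w i).2.1.1) (fun i => hD ⟨_, (w i).2.1.2, rfl⟩) hN
      rw [← pow_mul] at hupper
      have hsmall := pow_mul_lt_one_of_le_mul_rpow (E := Fintype.card (Fin (m + 1)) * b * μ)
        (F := A * b * (t * b ^ m)) hc hδ.le (one_le_two.trans hH) (by positivity) (by
          simp only [μ]
          rw [hcardι, Fintype.card_fin]
          push_cast
          have := mul_le_mul_of_nonneg_right hA
            (show (0 : ℝ) ≤ b * (t * b ^ m) by positivity)
          linarith) hδC
      have := mul_le_mul_of_nonneg_left hupper
        (show (0 : ℝ) ≤ (H : ℝ) ^ (Fintype.card (Fin (m + 1)) * b * μ) by positivity)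
      exact absurd (hlower.trans this) (not_le.mpr hsmall)
  obtain ⟨P, hP0, hPdeg, hPeval⟩ := exists_mvPolynomial_of_coeff φ hφ
  refine ⟨P, hP0, hPdeg, fun z hz hzq => ?_⟩
  rw [hPeval]
  exact hrel ⟨z, hz, hzq⟩
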